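/- The set of T-numbers in F_q((T^{-1})) is uncountable. -/

import Mathlib

open Polynomial Filter Set
open scoped Classical

noncomputable section

namespace OotoT

variable (Fq : Type) [Field Fq]

/-- We model the field `F_q((T⁻¹))` of Laurent series in `T⁻¹` as `LaurentSeries Fq`,
whose canonical variable `u` plays the role of `T⁻¹`.  Thus `T` itself is `u⁻¹`. -/
def Tel : LaurentSeries Fq := (HahnSeries.single (1 : ℤ) (1 : Fq))⁻¹

/-- The canonical ring embedding `F_q[T] → F_q((T⁻¹))`, sending `T ↦ u⁻¹`. -/
def ringHomT : Polynomial Fq →+* LaurentSeries Fq :=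
  Polynomial.eval₂RingHom (HahnSeries.C : Fq →+* LaurentSeries Fq) (Tel Fq)

/-- The absolute value on `F_q((T⁻¹))`: `|0| = 0` and `|ξ| = q^{-N}` where
`ξ = Σ_{n ≥ N} a_n T^{-n}` with `a_N ≠ 0`; in our model `N` is the order of `ξ`
as a Hahn series in `u = T⁻¹`. -/
def absL (q : ℕ) (ξ : LaurentSeries Fq) : ℝ :=
  if ξ = 0 then 0 else (q : ℝ) ^ (-ξ.order)

/-- Evaluation of a polynomial `P(X) ∈ (F_q[T])[X]` at `ξ ∈ F_q((T⁻¹))`. -/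
def evalP (ξ : LaurentSeries Fq) (P : Polynomial (Polynomial Fq)) : LaurentSeries Fq :=
  Polynomial.eval₂ (ringHomT Fq) ξ P

/-- The height of `P(X) ∈ (F_q[T])[X]`: the maximum of the absolute values of its
coefficients.  A nonzero `c ∈ F_q[T]` has `|c| = q^{deg c}`, so for `P ≠ 0` the height
is `q` raised to the maximal degree of a (nonzero) coefficient of `P`. -/
def heightP (q : ℕ) (P : Polynomial (Polynomial Fq)) : ℝ :=
  if P = 0 then 0 else (q : ℝ) ^ (P.support.sup fun i => (P.coeff i).natDegree)

/-- `w_n(ξ)`: the supremum (in the extended reals) of the real numbers `w` such that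
`0 < |P(ξ)| ≤ H(P)^{-w}` for infinitely many `P(X) ∈ (F_q[T])[X]` of degree at most `n`. -/
def wn (q : ℕ) (n : ℕ) (ξ : LaurentSeries Fq) : EReal :=
  sSup ((fun w : ℝ => (w : EReal)) ''
    {w : ℝ | {P : Polynomial (Polynomial Fq) | P.natDegree ≤ n ∧
      0 < absL Fq q (evalP Fq ξ P) ∧
      absL Fq q (evalP Fq ξ P) ≤ heightP Fq q P ^ (-w)}.Infinite})

/-- `w(ξ) = limsup_{n→∞} w_n(ξ)/n`. -/
def wB (q : ℕ) (ξ : LaurentSeries Fq) : EReal :=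
  Filter.limsup (fun n : ℕ => wn Fq q n ξ / (n : EReal)) Filter.atTop

/-- `ξ` is an `A`-number if `w(ξ) = 0`. -/
def IsANumber (q : ℕ) (ξ : LaurentSeries Fq) : Prop := wB Fq q ξ = 0

/-- `ξ` is an `S`-number if `0 < w(ξ) < +∞`. -/
def IsSNumber (q : ℕ) (ξ : LaurentSeries Fq) : Prop := 0 < wB Fq q ξ ∧ wB Fq q ξ < ⊤

/-- `ξ` is a `T`-number if `w(ξ) = +∞` and `w_n(ξ) < +∞` for all `n ≥ 1`. -/
def IsTNumber (q : ℕ) (ξ : LaurentSeries Fq) : Prop :=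
  wB Fq q ξ = ⊤ ∧ ∀ n : ℕ, 1 ≤ n → wn Fq q n ξ < ⊤

/-- `ξ` is a `U`-number if `w(ξ) = +∞` and `w_n(ξ) = +∞` for some `n ≥ 1`. -/
def IsUNumber (q : ℕ) (ξ : LaurentSeries Fq) : Prop :=
  wB Fq q ξ = ⊤ ∧ ∃ n : ℕ, 1 ≤ n ∧ wn Fq q n ξ = ⊤

/-- The type `t(ξ) = limsup_{n→∞} (log w_n(ξ))/(log n)` of a `T`-number (as an
extended real; for a `T`-number each `w_n(ξ)` is a finite real, recovered by `toReal`). -/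
def typeT (q : ℕ) (ξ : LaurentSeries Fq) : EReal :=
  Filter.limsup
    (fun n : ℕ => ((Real.log (wn Fq q n ξ).toReal / Real.log n : ℝ) : EReal)) Filter.atTop

/-! ### The algebraic closure side -/

/-- The algebraic closure of `F_q((T⁻¹))`. -/
abbrev AC := AlgebraicClosure (LaurentSeries Fq)

/-- The canonical embedding of `F_q((T⁻¹))` into its algebraic closure. -/
def iota : LaurentSeries Fq →+* AC Fq := algebraMap _ _

/-- The embedding `F_q[T] → AC`. -/
def ringHomTC : Polynomial Fq →+* AC Fq := (iota Fq).comp (ringHomT Fq)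

/-- Evaluation of `P(X) ∈ (F_q[T])[X]` at an element of the algebraic closure. -/
def evalPC (α : AC Fq) (P : Polynomial (Polynomial Fq)) : AC Fq :=
  Polynomial.eval₂ (ringHomTC Fq) α P

/-- `P ∈ (F_q[T])[X]` is *the* minimal polynomial of `α`: it is non-constant, irreducible,
primitive, its leading coefficient is monic (in `T`), and `P(α) = 0`.  For `α` algebraic
over `F_q(T)` such a polynomial exists and is unique. -/
def IsMinPolyOf (α : AC Fq) (P : Polynomial (Polynomial Fq)) : Prop :=
  0 < P.natDegree ∧ Irreducible P ∧ P.IsPrimitive ∧ P.leadingCoeff.Monic ∧ evalPC Fq α P = 0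

/-- `α` is algebraic over `F_q(T)`. -/
def IsAlgT (α : AC Fq) : Prop := ∃ P, IsMinPolyOf Fq α P

/-- The degree of an algebraic `α`: the degree of its minimal polynomial. -/
def degT (α : AC Fq) : ℕ := if h : IsAlgT Fq α then h.choose.natDegree else 0

/-- The height of an algebraic `α`: the height of its minimal polynomial. -/
def heightT (q : ℕ) (α : AC Fq) : ℝ := if h : IsAlgT Fq α then heightP Fq q h.choose else 0

/-- The unique extension of the absolute value to the algebraic closure of `F_q((T⁻¹))`,
given by the standard formula `|x| = |N_{K(x)/K}(x)|^{1/[K(x):K]}`, i.e.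
`|x| = |c₀|^{1/d}` where `c₀` is the constant coefficient and `d` the degree of the
minimal polynomial of `x` over `K = F_q((T⁻¹))`. -/
def absC (q : ℕ) (x : AC Fq) : ℝ :=
  absL Fq q ((minpoly (LaurentSeries Fq) x).coeff 0) ^
    (((minpoly (LaurentSeries Fq) x).natDegree : ℝ)⁻¹)

/-- `w_n^*(ξ)`: the supremum (in the extended reals) of the real numbers `w` such that
`0 < |ξ - α| ≤ H(α)^{-w-1}` for infinitely many `α` algebraic over `F_q(T)` of degree
at most `n`. -/
def wnStar (q : ℕ) (n : ℕ) (ξ : LaurentSeries Fq) : EReal :=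
  sSup ((fun w : ℝ => (w : EReal)) ''
    {w : ℝ | {α : AC Fq | IsAlgT Fq α ∧ degT Fq α ≤ n ∧
      0 < absC Fq q (iota Fq ξ - α) ∧
      absC Fq q (iota Fq ξ - α) ≤ heightT Fq q α ^ (-w - 1)}.Infinite})

/-- `w^*(ξ) = limsup_{n→∞} w_n^*(ξ)/n`. -/
def wBStar (q : ℕ) (ξ : LaurentSeries Fq) : EReal :=
  Filter.limsup (fun n : ℕ => wnStar Fq q n ξ / (n : EReal)) Filter.atTop

/-- `ξ` is an `A*`-number if `w^*(ξ) = 0`. -/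
def IsAStarNumber (q : ℕ) (ξ : LaurentSeries Fq) : Prop := wBStar Fq q ξ = 0

/-- `ξ` is a `T*`-number if `w^*(ξ) = +∞` and `w_n^*(ξ) < +∞` for all `n ≥ 1`. -/
def IsTStarNumber (q : ℕ) (ξ : LaurentSeries Fq) : Prop :=
  wBStar Fq q ξ = ⊤ ∧ ∀ n : ℕ, 1 ≤ n → wnStar Fq q n ξ < ⊤

/-- The `*`-type `t^*(ξ) = limsup_{n→∞} (log w_n^*(ξ))/(log n)` of a `T*`-number. -/
def typeTStar (q : ℕ) (ξ : LaurentSeries Fq) : EReal :=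
  Filter.limsup
    (fun n : ℕ => ((Real.log (wnStar Fq q n ξ).toReal / Real.log n : ℝ) : EReal)) Filter.atTop

/-! ### The Laurent series `ξ(r, m)` -/

/-- `r_j = r^{m_0 m_1 ⋯ m_j}`. -/
def rr (r : ℕ) (m : ℕ → ℕ) (j : ℕ) : ℕ := r ^ (∏ i ∈ Finset.range (j + 1), m i)

/-- `α_j(r, m) = Σ_{n=1}^∞ T^{-r_j^n}`, i.e. the power series in `u = T⁻¹` whose
`k`-th coefficient is `1` exactly when `k = r_j^n` for some `n ≥ 1`. -/
def alphaJ (r : ℕ) (m : ℕ → ℕ) (j : ℕ) : LaurentSeries Fq :=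
  HahnSeries.ofPowerSeries ℤ Fq (PowerSeries.mk fun k =>
    if ∃ n : ℕ, 1 ≤ n ∧ k = rr r m j ^ n then 1 else 0)

/-- `ξ_a(r, m) = Σ_{j=0}^∞ a_j α_j(r, m)`, described coefficientwise: the coefficient of
`T^{-k}` is the (finite) sum over `j` of `a_j` times the coefficient of `T^{-k}` in
`α_j(r, m)`. -/
def xiA (r : ℕ) (m : ℕ → ℕ) (a : ℕ → ℕ) : LaurentSeries Fq :=
  HahnSeries.ofPowerSeries ℤ Fq (PowerSeries.mk fun k =>
    ∑ᶠ j : ℕ, (a j : Fq) * (if ∃ n : ℕ, 1 ≤ n ∧ k = rr r m j ^ n then 1 else 0))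

/-- `ξ(r, m) = Σ_{j=0}^∞ α_j(r, m)`. -/
def xi (r : ℕ) (m : ℕ → ℕ) : LaurentSeries Fq := xiA Fq r m fun _ => 1

/-! ### Algebraicity and algebraic dependence over `F_q(T)` for Laurent series -/

/-- `ξ ∈ F_q((T⁻¹))` is algebraic over `F_q(T)`. -/
def IsAlgLS (ξ : LaurentSeries Fq) : Prop :=
  ∃ P : Polynomial (Polynomial Fq), P ≠ 0 ∧ evalP Fq ξ P = 0

/-- Evaluation of a two-variable polynomial `F(X, Y) ∈ (F_q[T])[X, Y]` (coded as an
iterated polynomial ring, `T` innermost, then `X`, then `Y`) at `(ξ, η)`. -/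
def evalXY (ξ η : LaurentSeries Fq) (F : Polynomial (Polynomial (Polynomial Fq))) :
    LaurentSeries Fq :=
  Polynomial.eval₂ (Polynomial.eval₂RingHom (ringHomT Fq) ξ) η F

/-- `ξ` and `η` are algebraically dependent over `F_q(T)`. -/
def AlgDep (ξ η : LaurentSeries Fq) : Prop :=
  ∃ F : Polynomial (Polynomial (Polynomial Fq)), F ≠ 0 ∧ evalXY Fq ξ η F = 0

/-- `deg_X` of `F(X, Y) ∈ (F_q[T])[X, Y]` in our encoding. -/
def degX (F : Polynomial (Polynomial (Polynomial Fq))) : ℕ :=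
  F.support.sup fun i => (F.coeff i).natDegree

/-- `F(X, Y) ∈ (F_q[T])[X, Y]` is primitive (in `X` and `Y`): no non-unit of `F_q[T]`
divides all of its coefficients. -/
def IsPrimitiveXY (F : Polynomial (Polynomial (Polynomial Fq))) : Prop :=
  ∀ c : Polynomial Fq, (∀ i j : ℕ, c ∣ ((F.coeff i).coeff j)) → IsUnit c

end OotoT

open OotoT

namespace OotoT

section AbsoluteValue

variable {Fq : Type} [Field Fq] {q : ℕ}

lemma absL_zero : absL Fq q 0 = 0 := by simp [absL]

lemma absL_nonneg (x : LaurentSeries Fq) : 0 ≤ absL Fq q x := by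
  unfold absL; split_ifs <;> positivity

lemma absL_one : absL Fq q 1 = 1 := by simp [absL]

lemma absL_pos (hq : 1 < q) {x : LaurentSeries Fq} (hx : x ≠ 0) : 0 < absL Fq q x := by
  rw [absL, if_neg hx]; positivity

lemma absL_mul (hq : 1 < q) (x y : LaurentSeries Fq) :
    absL Fq q (x * y) = absL Fq q x * absL Fq q y := by
  rcases eq_or_ne x 0 with rfl | hx
  · simp [absL]
  rcases eq_or_ne y 0 with rfl | hy
  · simp [absL]
  have h0 : (q : ℝ) ≠ 0 := by positivity
  rw [absL, absL, absL, if_neg hx, if_neg hy, if_neg (mul_ne_zero hx hy),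
    HahnSeries.order_mul hx hy, ← zpow_add₀ h0]
  congr 1
  ring

lemma absL_pow (hq : 1 < q) (x : LaurentSeries Fq) (n : ℕ) :
    absL Fq q (x ^ n) = absL Fq q x ^ n := by
  induction n with
  | zero => simp [absL_one]
  | succ n ih => rw [pow_succ, absL_mul hq, ih, pow_succ]

lemma absL_add_le (hq : 1 < q) (x y : LaurentSeries Fq) :
    absL Fq q (x + y) ≤ max (absL Fq q x) (absL Fq q y) := by
  rcases eq_or_ne x 0 with rfl | hx
  · simp
  rcases eq_or_ne y 0 with rfl | hy
  · simp
  by_cases hxy : x + y = 0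
  · rw [hxy, absL_zero]
    exact le_max_of_le_left (absL_nonneg x)
  have h1 : (1 : ℝ) ≤ q := by exact_mod_cast hq.le
  have := HahnSeries.min_order_le_order_add hxy
  rw [absL, absL, absL, if_neg hx, if_neg hy, if_neg hxy, le_max_iff]
  rcases min_le_iff.1 this with h | h
  · exact Or.inl (zpow_le_zpow_right₀ h1 (by lia))
  · exact Or.inr (zpow_le_zpow_right₀ h1 (by lia))

lemma absL_sum_le (hq : 1 < q) {ι : Type*} (s : Finset ι) (f : ι → LaurentSeries Fq) {b : ℝ}
    (hb : 0 ≤ b) (h : ∀ i ∈ s, absL Fq q (f i) ≤ b) : absL Fq q (∑ i ∈ s, f i) ≤ b := by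
  induction s using Finset.induction_on with
  | empty => simpa [absL_zero] using hb
  | insert a s ha ih =>
    rw [Finset.sum_insert ha]
    exact (absL_add_le hq _ _).trans (max_le (h a (by simp))
      (ih fun i hi => h i (Finset.mem_insert_of_mem hi)))

lemma absL_ofPowerSeries_le (hq : 1 < q) {f : PowerSeries Fq} {n : ℕ} (h : PowerSeries.X ^ n ∣ f) :
    absL Fq q (HahnSeries.ofPowerSeries ℤ Fq f) ≤ (q : ℝ) ^ (-(n : ℤ)) := by
  unfold absL
  split_ifs with h0
  · positivity
  refine zpow_le_zpow_right₀ (by exact_mod_cast hq.le) (neg_le_neg ?_)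
  by_contra! hlt
  obtain ⟨m, hm⟩ | hneg : (∃ m : ℕ, (HahnSeries.ofPowerSeries ℤ Fq f).order = m) ∨
      (HahnSeries.ofPowerSeries ℤ Fq f).order < 0 := by
    rcases lt_or_ge (HahnSeries.ofPowerSeries ℤ Fq f).order 0 with h | h
    · exact Or.inr h
    · exact Or.inl ⟨_, (Int.toNat_of_nonneg h).symm⟩
  · refine h0 (HahnSeries.coeff_order_eq_zero.1 ?_)
    rw [hm, HahnSeries.ofPowerSeries_apply_coeff]
    exact (PowerSeries.X_pow_dvd_iff.1 h) m (by lia)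
  · refine h0 (HahnSeries.coeff_order_eq_zero.1 ?_)
    generalize (HahnSeries.ofPowerSeries ℤ Fq f).order = k at hneg
    rw [HahnSeries.ofPowerSeries_apply]
    apply HahnSeries.embDomain_of_notMem_range
    rintro ⟨m, hm⟩
    simp only [Nat.castOrderEmbedding_apply] at hm
    lia

lemma absL_ofPowerSeries_le_one (hq : 1 < q) (f : PowerSeries Fq) :
    absL Fq q (HahnSeries.ofPowerSeries ℤ Fq f) ≤ 1 := by
  simpa using absL_ofPowerSeries_le (n := 0) hq (by simp : PowerSeries.X ^ 0 ∣ f)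

lemma Tel_pow (n : ℕ) : Tel Fq ^ n = HahnSeries.single (-(n : ℤ)) (1 : Fq) := by
  rw [Tel, HahnSeries.inv_single, HahnSeries.single_pow]
  simp

lemma absL_Tel_pow (n : ℕ) : absL Fq q (Tel Fq ^ n) = (q : ℝ) ^ n := by
  rw [Tel_pow, absL, if_neg (by simp), HahnSeries.order_single one_ne_zero]
  simp

lemma ringHomT_X : ringHomT Fq X = Tel Fq := by simp [ringHomT]

lemma ringHomT_C (a : Fq) : ringHomT Fq (C a) = HahnSeries.C a := by simp [ringHomT]

lemma coeff_ringHomT (c : Fq[X]) (n : ℕ) : (ringHomT Fq c).coeff (-(n : ℤ)) = c.coeff n := by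
  induction c using Polynomial.induction_on' with
  | add f g hf hg => simp [hf, hg]
  | monomial m a =>
    rw [← C_mul_X_pow_eq_monomial, map_mul, map_pow, ringHomT_X, ringHomT_C, Tel_pow,
      HahnSeries.C_mul_eq_smul, HahnSeries.coeff_smul, HahnSeries.coeff_single]
    simp [Polynomial.coeff_X_pow]

lemma ringHomT_injective : Function.Injective (ringHomT Fq) := by
  intro a b h
  ext n
  rw [← coeff_ringHomT, ← coeff_ringHomT, h]

lemma one_le_absL_ringHomT (hq : 1 < q) {c : Fq[X]} (hc : c ≠ 0) :
    1 ≤ absL Fq q (ringHomT Fq c) := by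
  have h0 : ringHomT Fq c ≠ 0 := (map_ne_zero_iff _ ringHomT_injective).2 hc
  rw [absL, if_neg h0]
  refine one_le_zpow₀ (by exact_mod_cast hq.le) ?_
  have : (ringHomT Fq c).order ≤ -(c.natDegree : ℤ) := by
    apply HahnSeries.order_le_of_coeff_ne_zero
    rw [coeff_ringHomT]
    simpa using hc
  lia

lemma absL_C_le (hq : 1 < q) (a : Fq) : absL Fq q (HahnSeries.C a) ≤ 1 := by
  rw [← HahnSeries.ofPowerSeries_C (Γ := ℤ)]
  exact absL_ofPowerSeries_le_one hq _

lemma absL_ringHomT_le (hq : 1 < q) {c : Fq[X]} {d : ℕ} (hc : c.natDegree ≤ d) :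
    absL Fq q (ringHomT Fq c) ≤ (q : ℝ) ^ d := by
  have h1 : (1 : ℝ) ≤ q := by exact_mod_cast hq.le
  rw [c.as_sum_range_C_mul_X_pow, map_sum]
  refine absL_sum_le hq _ _ (by positivity) fun i hi => ?_
  rw [map_mul, map_pow, ringHomT_X, ringHomT_C, absL_mul hq, absL_Tel_pow]
  calc _ ≤ 1 * (q : ℝ) ^ d := by
        gcongr
        · exact absL_C_le hq _
        · have := Finset.mem_range.1 hi
          lia
    _ = _ := one_mul _

end AbsoluteValue

section Resultant

lemma natDegree_det_le {R ι : Type*} [CommRing R] [Fintype ι] [DecidableEq ι]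
    (M : Matrix ι ι R[X]) {d : ℕ} (h : ∀ i j, (M i j).natDegree ≤ d) :
    M.det.natDegree ≤ Fintype.card ι * d := by
  rw [Matrix.det_apply]
  refine natDegree_sum_le_of_forall_le _ _ fun σ _ => (natDegree_smul_le _ _).trans ?_
  refine (natDegree_prod_le _ _).trans ((Finset.sum_le_card_nsmul _ _ d fun i _ => h _ _).trans ?_)
  simp

lemma natDegree_adjugate_le {R ι : Type*} [CommRing R] [Fintype ι] [DecidableEq ι]
    (M : Matrix ι ι R[X]) {d : ℕ} (h : ∀ i j, (M i j).natDegree ≤ d) (i j : ι) :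
    (M.adjugate i j).natDegree ≤ Fintype.card ι * d := by
  rw [Matrix.adjugate_apply]
  refine natDegree_det_le _ fun k l => ?_
  rw [Matrix.updateRow_apply]
  split_ifs
  · rw [Pi.single_apply]
    split_ifs <;> simp
  · exact h k l

lemma sylvester_castAdd {R : Type*} [CommRing R] (f g : R[X]) {m n : ℕ} (hg : g.natDegree ≤ n)
    (i : Fin (m + n)) (j : Fin m) :
    sylvester f g m n i (Fin.castAdd n j) = (g * X ^ (j : ℕ)).coeff i := by
  rw [coeff_mul_X_pow']
  simp only [sylvester, Matrix.of_apply, Fin.addCases_left, Set.mem_Icc]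
  split_ifs with h₁ h₂ h₂ <;> first | rfl | lia | skip
  exact (coeff_eq_zero_of_natDegree_lt (by lia)).symm

lemma sylvester_natAdd {R : Type*} [CommRing R] (f g : R[X]) {m n : ℕ} (hf : f.natDegree ≤ m)
    (i : Fin (m + n)) (j : Fin n) :
    sylvester f g m n i (Fin.natAdd m j) = (f * X ^ (j : ℕ)).coeff i := by
  rw [coeff_mul_X_pow']
  simp only [sylvester, Matrix.of_apply, Fin.addCases_right, Set.mem_Icc]
  split_ifs with h₁ h₂ h₂ <;> first | rfl | lia | skip
  exact (coeff_eq_zero_of_natDegree_lt (by lia)).symm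

lemma sum_pow_mul_coeff_mul_X_pow {R S : Type*} [CommRing R] [CommRing S] (φ : R →+* S) (x : S)
    (f : R[X]) {N j : ℕ} (h : f.natDegree + j < N) :
    ∑ i : Fin N, x ^ (i : ℕ) * φ ((f * X ^ j).coeff i) = x ^ j * f.eval₂ φ x := by
  have hdeg : (f * X ^ j).natDegree < N :=
    (natDegree_mul_le.trans (Nat.add_le_add_left (natDegree_X_pow_le j) _)).trans_lt h
  have := eval₂_eq_sum_range' φ hdeg x
  rw [eval₂_mul, eval₂_X_pow] at this
  rw [mul_comm (x ^ j), this, Finset.sum_range]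
  exact Finset.sum_congr rfl fun i _ => mul_comm _ _

variable {Fq : Type} [Field Fq] {q : ℕ}

/-- A quantitative form of the fact that two polynomials with non-zero resultant cannot both be
small at the same point. -/
lemma one_le_max_mul_of_resultant_ne_zero (hq : 1 < q) {ξ : LaurentSeries Fq}
    (hξ : absL Fq q ξ ≤ 1) {P Q : Fq[X][X]} {d : ℕ} (hP : ∀ i, (P.coeff i).natDegree ≤ d)
    (hQ : ∀ i, (Q.coeff i).natDegree ≤ d) (hdeg : 0 < P.natDegree + Q.natDegree)
    (hres : P.resultant Q ≠ 0) :
    1 ≤ max (absL Fq q (evalP Fq ξ P)) (absL Fq q (evalP Fq ξ Q)) *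
      (q : ℝ) ^ ((P.natDegree + Q.natDegree) * d) := by
  set m := P.natDegree with hm
  set n := Q.natDegree with hn
  set S := sylvester P Q m n with hS
  set b := max (absL Fq q (evalP Fq ξ P)) (absL Fq q (evalP Fq ξ Q)) with hb
  have hb0 : 0 ≤ b := le_max_of_le_left (absL_nonneg _)
  let v : Fin (m + n) → LaurentSeries Fq := fun i => ξ ^ (i : ℕ)
  let i₀ : Fin (m + n) := ⟨0, hdeg⟩
  have hpow : ∀ j : ℕ, absL Fq q (ξ ^ j) ≤ 1 := fun j => by
    rw [absL_pow hq]
    exact pow_le_one₀ (absL_nonneg _) hξ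
  have hcol : ∀ j, absL Fq q (∑ i, v i * ringHomT Fq (S i j)) ≤ b := by
    intro j
    induction j using Fin.addCases with
    | left j =>
      simp only [hS, sylvester_castAdd P Q hn.ge, v]
      rw [sum_pow_mul_coeff_mul_X_pow _ _ _ (by lia), absL_mul hq]
      exact (mul_le_of_le_one_left (absL_nonneg _) (hpow _)).trans (le_max_right _ _)
    | right j =>
      simp only [hS, sylvester_natAdd P Q hm.ge, v]
      rw [sum_pow_mul_coeff_mul_X_pow _ _ _ (by lia), absL_mul hq]
      exact (mul_le_of_le_one_left (absL_nonneg _) (hpow _)).trans (le_max_left _ _)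
  have hentry : ∀ i j, (S i j).natDegree ≤ d := by
    intro i j
    induction j using Fin.addCases with
    | left j =>
      rw [hS, sylvester_castAdd P Q hn.ge, coeff_mul_X_pow']
      split_ifs <;> simp [hQ]
    | right j =>
      rw [hS, sylvester_natAdd P Q hm.ge, coeff_mul_X_pow']
      split_ifs <;> simp [hP]
  have hdet : ringHomT Fq S.det =
      ∑ j, (∑ i, v i * ringHomT Fq (S i j)) * ringHomT Fq (S.adjugate j i₀) := by
    have h1 : ∀ i, ∑ j, S i j * S.adjugate j i₀ = if i = i₀ then S.det else 0 := fun i => by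
      rw [← Matrix.mul_apply, Matrix.mul_adjugate, Matrix.smul_apply, Matrix.one_apply]
      simp
    calc ringHomT Fq S.det = ∑ i, v i * ringHomT Fq (∑ j, S i j * S.adjugate j i₀) := by
          simp only [h1, apply_ite (ringHomT Fq), map_zero, mul_ite, mul_zero]
          simp [v, i₀]
      _ = _ := by
          simp only [map_sum, map_mul, Finset.mul_sum, Finset.sum_mul]
          rw [Finset.sum_comm]
          simp only [mul_assoc]
  calc (1 : ℝ) ≤ absL Fq q (ringHomT Fq S.det) := one_le_absL_ringHomT hq hres
    _ ≤ b * (q : ℝ) ^ ((m + n) * d) := by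
        rw [hdet]
        refine absL_sum_le hq _ _ (by positivity) fun j _ => ?_
        rw [absL_mul hq]
        refine mul_le_mul (hcol j) (absL_ringHomT_le hq ?_) (absL_nonneg _) hb0
        simpa using natDegree_adjugate_le S hentry j i₀

end Resultant

section Coprime

lemma isCoprime_sub_C {K : Type*} [Field K] (f : K[X]) {a b : K} (h : a ≠ b) :
    IsCoprime (f - C a) (f - C b) := by
  have hc : (C (a - b)⁻¹ : K[X]) * (C a - C b) = 1 := by
    rw [← C_sub, ← C_mul, inv_mul_cancel₀ (sub_ne_zero.2 h), C_1]
  exact ⟨-C (a - b)⁻¹, C (a - b)⁻¹, by linear_combination hc⟩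

lemma exists_isCoprime_sub_C {K : Type*} [Field K] {R : K[X]} (hR : R ≠ 0) {n : ℕ}
    (hn : R.natDegree ≤ n) (f : K[X]) {γ : ℕ → K} (hγ : Function.Injective γ) :
    ∃ t ≤ n, IsCoprime R (f - C (γ t)) := by
  by_contra! h
  have hex : ∀ t, ∃ g : K[X], t ≤ n → Irreducible g ∧ g ∣ R ∧ g ∣ f - C (γ t) := by
    intro t
    by_cases ht : t ≤ n
    · by_contra! hg
      refine h t ht (isCoprime_of_irreducible_dvd (by simp [hR]) fun z hz hzR hzf => ?_)
      exact (hg z).2 hz hzR hzf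
    · exact ⟨0, fun h => absurd h ht⟩
  choose g hg using hex
  have hdvd : ∏ t ∈ Finset.range (n + 1), g t ∣ R := by
    refine Finset.prod_dvd_of_coprime (fun s hs t ht hst => ?_) fun t ht => ?_
    · simp only [Finset.coe_range, Set.mem_Iio, Nat.lt_succ_iff] at hs ht
      exact ((isCoprime_sub_C f (hγ.ne hst)).of_isCoprime_of_dvd_left
        (hg s hs).2.2).of_isCoprime_of_dvd_right (hg t ht).2.2
    · exact (hg t (Nat.lt_succ_iff.1 (Finset.mem_range.1 ht))).2.1
  have hle := natDegree_le_of_dvd hdvd hR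
  have hirr : ∀ t ∈ Finset.range (n + 1), Irreducible (g t) := fun t ht =>
    (hg t (Nat.lt_succ_iff.1 (Finset.mem_range.1 ht))).1
  rw [natDegree_prod _ _ fun t ht => (hirr t ht).ne_zero] at hle
  have hcard := Finset.card_nsmul_le_sum (Finset.range (n + 1)) (fun t => (g t).natDegree) 1
    fun t ht => (hirr t ht).natDegree_pos
  simp only [Finset.card_range, smul_eq_mul, mul_one] at hcard
  lia

end Coprime

section Digits

/-- The number of `j ∈ S` such that `16 ^ j` divides `k` (and `0` if `k = 0`). -/
def digit (S : Set ℕ) (k : ℕ) : ℕ := {j ∈ Finset.range k | j ∈ S ∧ 16 ^ j ∣ k}.card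

@[simp]
lemma digit_zero (S : Set ℕ) : digit S 0 = 0 := rfl

lemma digit_eq_card {S : Set ℕ} {k n : ℕ} (hk : 0 < k) (h : ∀ j, 16 ^ j ∣ k → j < n) :
    digit S k = {j ∈ Finset.range n | j ∈ S ∧ 16 ^ j ∣ k}.card := by
  unfold digit
  congr 1
  ext j
  simp only [Finset.mem_filter, Finset.mem_range, and_congr_left_iff, and_imp]
  intro _ hj
  have : j < k := (Nat.lt_pow_self (by norm_num)).trans_le (Nat.le_of_dvd hk hj)
  exact ⟨fun _ => h j hj, fun _ => this⟩

lemma digit_sub_eq {S : Set ℕ} {J k : ℕ} (hk : 16 ^ J < k) (h₁ : ¬ 16 ^ (J + 1) ∣ k)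
    (h₂ : ¬ 16 ^ (J + 1) ∣ k - 16 ^ J) : digit S (k - 16 ^ J) = digit S k := by
  have key : ∀ l, ¬ 16 ^ (J + 1) ∣ l → ∀ j, 16 ^ j ∣ l → j < J + 1 := fun l hl j hj => by
    by_contra! hJ
    exact hl ((pow_dvd_pow 16 hJ).trans hj)
  rw [digit_eq_card (by lia) (key _ h₁), digit_eq_card (by lia) (key _ h₂)]
  congr 1
  ext j
  simp only [Finset.mem_filter, Finset.mem_range, and_congr_right_iff]
  intro hj _
  exact Nat.dvd_sub_iff_left hk.le (pow_dvd_pow 16 (Nat.lt_succ_iff.1 hj))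

lemma digit_eq_digit_sub_add_one {S : Set ℕ} {J : ℕ} (hJ : J + 1 ∈ S) (s : ℕ) :
    digit S ((16 * s + 1) * 16 ^ (J + 1)) =
      digit S ((16 * s + 1) * 16 ^ (J + 1) - 16 ^ J) + 1 := by
  have hpos : 0 < 16 ^ J := by positivity
  have hlt : 16 ^ J < (16 * s + 1) * 16 ^ (J + 1) := by rw [pow_succ]; nlinarith
  set k := (16 * s + 1) * 16 ^ (J + 1) with hk
  have h₁ : ∀ j, 16 ^ j ∣ k → j < J + 2 := fun j hj => by
    by_contra! hJj
    have h := (pow_dvd_pow 16 hJj).trans hj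
    rw [hk, show J + 2 = J + 1 + 1 from rfl, pow_succ 16 (J + 1), mul_comm,
      Nat.mul_dvd_mul_iff_right (by positivity)] at h
    lia
  have h₂ : ∀ j, 16 ^ j ∣ k - 16 ^ J → j < J + 1 := fun j hj => by
    by_contra! hJj
    have h := (pow_dvd_pow 16 hJj).trans hj
    rw [Nat.dvd_sub_iff_right hlt.le (hk ▸ dvd_mul_left _ _)] at h
    exact absurd (Nat.le_of_dvd hpos h) (by rw [pow_succ]; lia)
  rw [digit_eq_card (by lia) h₁, digit_eq_card (by lia) h₂, Finset.range_add_one (n := J + 1),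
    Finset.filter_insert, if_pos ⟨hJ, hk ▸ dvd_mul_left _ _⟩, Finset.card_insert_of_notMem (by simp)]
  congr 2
  ext j
  simp only [Finset.mem_filter, Finset.mem_range, and_congr_right_iff]
  intro hj _
  exact (Nat.dvd_sub_iff_left hlt.le (pow_dvd_pow 16 (Nat.lt_succ_iff.1 hj))).symm

lemma digit_sixteen_pow (S : Set ℕ) (n : ℕ) :
    digit S (16 ^ n) = {j ∈ Finset.range (n + 1) | j ∈ S}.card := by
  rw [digit_eq_card (n := n + 1) (by positivity) fun j hj =>
    Nat.lt_succ_iff.2 ((Nat.pow_dvd_pow_iff_le_right (by norm_num)).1 hj)]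
  congr 1
  ext j
  simp only [Finset.mem_filter, Finset.mem_range, and_congr_right_iff, and_iff_left_iff_imp]
  intro hj _
  exact pow_dvd_pow 16 (Nat.lt_succ_iff.1 hj)

end Digits

section Series

variable (Fq : Type) [Field Fq] (p : ℕ)

/-- The power series `∑ k ≥ 1, digit S k * u ^ (p ^ k)`. -/
def gapSeries (S : Set ℕ) : PowerSeries Fq :=
  PowerSeries.mk fun m => if p ^ Nat.log p m = m then (digit S (Nat.log p m) : Fq) else 0

/-- The coefficient of `u ^ (p ^ k)` in `f ^ (p ^ M) - f`, where `f = gapSeries Fq p S`. -/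
def asCoeff (S : Set ℕ) (M k : ℕ) : Fq := (digit S (k - M) : Fq) - digit S k

/-- The truncation of `f ^ (p ^ M) - f` for `f = gapSeries Fq p S` at `u ^ (p ^ N)`. -/
def asTrunc (S : Set ℕ) (M N : ℕ) : PowerSeries Fq :=
  ∑ k ∈ Finset.range N, PowerSeries.C (asCoeff Fq S M k) * PowerSeries.X ^ p ^ k

variable {Fq p}

lemma coeff_sum_C_mul_X_pow (hp : 1 < p) (a : ℕ → Fq) (N k : ℕ) :
    PowerSeries.coeff (p ^ k)
      (∑ j ∈ Finset.range N, PowerSeries.C (a j) * PowerSeries.X ^ p ^ j) =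
      if k < N then a k else 0 := by
  simp [PowerSeries.coeff_X_pow, (Nat.pow_right_injective hp).eq_iff]

lemma X_pow_dvd_gapSeries_sub (hp : 1 < p) (S : Set ℕ) (N : ℕ) :
    PowerSeries.X ^ p ^ N ∣ gapSeries Fq p S -
      ∑ k ∈ Finset.range N, PowerSeries.C (digit S k : Fq) * PowerSeries.X ^ p ^ k := by
  rw [PowerSeries.X_pow_dvd_iff]
  intro m hm
  rw [map_sub, sub_eq_zero, gapSeries, PowerSeries.coeff_mk]
  split_ifs with h
  · rw [← h, coeff_sum_C_mul_X_pow hp, Nat.log_pow hp, if_pos]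
    rw [← h] at hm
    exact (Nat.pow_lt_pow_iff_right hp).1 hm
  · rw [map_sum, eq_comm]
    refine Finset.sum_eq_zero fun k _ => ?_
    rw [PowerSeries.coeff_C_mul, PowerSeries.coeff_X_pow, if_neg, mul_zero]
    rintro rfl
    exact h (by rw [Nat.log_pow hp])

lemma X_pow_dvd_gapSeries_pow_sub [CharP Fq p] (hp : p.Prime) (S : Set ℕ) {M N : ℕ} (hMN : M ≤ N) :
    PowerSeries.X ^ p ^ N ∣
      gapSeries Fq p S ^ p ^ M - gapSeries Fq p S - asTrunc Fq p S M N := by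
  have : Fact p.Prime := ⟨hp⟩
  have : CharP (PowerSeries Fq) p :=
    charP_of_injective_ringHom (PowerSeries.C_injective (R := Fq)) p
  obtain ⟨L, rfl⟩ := Nat.exists_eq_add_of_le hMN
  have h₁ := X_pow_dvd_gapSeries_sub (Fq := Fq) hp.one_lt S (M + L)
  have h₂ := pow_dvd_pow_of_dvd (X_pow_dvd_gapSeries_sub (Fq := Fq) hp.one_lt S L) (p ^ M)
  rw [← pow_mul, ← pow_add, add_comm L M, sub_pow_char_pow, sum_pow_char_pow] at h₂
  have h₃ : ∑ k ∈ Finset.range L,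
        (PowerSeries.C (digit S k : Fq) * PowerSeries.X ^ p ^ k) ^ p ^ M =
      ∑ k ∈ Finset.range (M + L),
        PowerSeries.C (digit S (k - M) : Fq) * PowerSeries.X ^ p ^ k := by
    rw [Finset.sum_range_add, Finset.sum_eq_zero (s := Finset.range M), zero_add]
    · refine Finset.sum_congr rfl fun k _ => ?_
      rw [mul_pow, ← pow_mul, ← pow_add, ← map_pow, Nat.add_sub_cancel_left, add_comm k M,
        ← iterateFrobenius_def, map_natCast]
    · intro k hk
      rw [Nat.sub_eq_zero_of_le (Finset.mem_range.1 hk).le]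
      simp
  rw [h₃] at h₂
  convert dvd_sub h₂ h₁ using 1
  simp only [asTrunc, asCoeff, map_sub, sub_mul, Finset.sum_sub_distrib]
  ring

lemma asTrunc_eq {S : Set ℕ} {J : ℕ} (i : ℕ) :
    asTrunc Fq p S (16 ^ J) ((i + 1) * 16 ^ (J + 1)) =
      asTrunc Fq p S (16 ^ J) (i * 16 ^ (J + 1) + 16 ^ J + 1) := by
  have hpos : 0 < 16 ^ J := by positivity
  unfold asTrunc
  symm
  apply Finset.sum_subset
  · apply Finset.range_subset_range.2
    rw [pow_succ]
    nlinarith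
  · intro k hk hk'
    simp only [Finset.mem_range] at hk hk'
    have hnd : ∀ l, i * 16 ^ (J + 1) < l → l < (i + 1) * 16 ^ (J + 1) → ¬ 16 ^ (J + 1) ∣ l := by
      rintro l h₁ h₂ ⟨c, rfl⟩
      rw [mul_comm _ c] at h₁ h₂
      exact absurd (Nat.lt_of_mul_lt_mul_right h₁)
        (not_lt.2 (Nat.lt_succ_iff.1 (Nat.lt_of_mul_lt_mul_right h₂)))
    rw [asCoeff, digit_sub_eq (by lia) (hnd _ (by lia) hk) (hnd _ (by lia) (by lia))]
    simp

/-- For `J + 1 ∈ S` the truncations at the chosen places are distinct. -/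
lemma asTrunc_injective [CharP Fq p] (hp : p.Prime) {S : Set ℕ} {J : ℕ} (hJ : J + 1 ∈ S) :
    Function.Injective fun s : ℕ =>
      asTrunc Fq p S (16 ^ J) ((16 * s + 1) * 16 ^ (J + 1) + 16 ^ J + 1) := by
  intro s t hst
  by_contra hne
  wlog hlt : s < t generalizing s t
  · exact this hst.symm (Ne.symm hne) (by lia)
  have h := congrArg (PowerSeries.coeff (p ^ ((16 * t + 1) * 16 ^ (J + 1)))) hst
  simp only [asTrunc] at h
  have hpos : 0 < 16 ^ J := by positivity
  have hle : (16 * s + 1) * 16 ^ (J + 1) + 16 ^ J + 1 ≤ (16 * t + 1) * 16 ^ (J + 1) := by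
    rw [pow_succ]
    nlinarith
  rw [coeff_sum_C_mul_X_pow hp.one_lt, coeff_sum_C_mul_X_pow hp.one_lt, if_neg (not_lt.2 hle),
    if_pos (by lia), asCoeff, digit_eq_digit_sub_add_one hJ] at h
  simp at h

lemma gapSeries_injective [CharP Fq p] (hp : p.Prime) : Function.Injective (gapSeries Fq p) := by
  intro S S' h
  have h₁ : ∀ k, (digit S k : Fq) = digit S' k := fun k => by
    have := congrArg (PowerSeries.coeff (p ^ k)) h
    simpa [gapSeries, Nat.log_pow hp.one_lt] using this
  have h₂ : ∀ n, (({j ∈ Finset.range n | j ∈ S}.card : ℕ) : Fq) =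
      ({j ∈ Finset.range n | j ∈ S'}.card : ℕ) := by
    rintro (_ | n)
    · simp
    · rw [← digit_sixteen_pow, ← digit_sixteen_pow, h₁]
  ext n
  have h₃ := h₂ (n + 1)
  rw [Finset.range_add_one, Finset.filter_insert, Finset.filter_insert] at h₃
  by_cases hS : n ∈ S <;> by_cases hS' : n ∈ S' <;>
    simp_all [Finset.card_insert_of_notMem]

end Series

section Approximation

variable (Fq : Type) [Field Fq] (p : ℕ)

/-- The series `gapSeries Fq p S` as an element of `F_q((T⁻¹))`. -/
def gapNumber (S : Set ℕ) : LaurentSeries Fq := HahnSeries.ofPowerSeries ℤ Fq (gapSeries Fq p S)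

/-- The polynomial `T ^ E * (X ^ A - X - c)`, where `A = p ^ (16 ^ J)`, `c` is the truncation of
`ξ ^ A - ξ` with `ξ = gapNumber Fq p S` and `T ^ E` is the denominator of `c`. -/
def approxPoly (S : Set ℕ) (J i : ℕ) : Fq[X][X] :=
  C (X ^ p ^ (i * 16 ^ (J + 1) + 16 ^ J)) * (X ^ p ^ 16 ^ J - X) -
    C (∑ k ∈ Finset.range (i * 16 ^ (J + 1) + 16 ^ J + 1),
      C (asCoeff Fq S (16 ^ J) k) * X ^ (p ^ (i * 16 ^ (J + 1) + 16 ^ J) - p ^ k))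

/-- The constant `c` in the definition of `approxPoly`. -/
def approxConst (S : Set ℕ) (J i : ℕ) : LaurentSeries Fq :=
  HahnSeries.ofPowerSeries ℤ Fq (asTrunc Fq p S (16 ^ J) (i * 16 ^ (J + 1) + 16 ^ J + 1))

variable {Fq p} {S : Set ℕ} {J : ℕ}

lemma Tel_pow_mul_single_pow {m n : ℕ} (h : m ≤ n) :
    Tel Fq ^ n * HahnSeries.single (1 : ℤ) (1 : Fq) ^ m = Tel Fq ^ (n - m) := by
  rw [Tel_pow, Tel_pow, HahnSeries.single_pow, HahnSeries.single_mul_single]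
  congr 1
  · simp [h, neg_add_eq_sub]
  · simp

lemma map_approxPoly (hp : p.Prime) (i : ℕ) :
    (approxPoly Fq p S J i).map (ringHomT Fq) =
      C (Tel Fq ^ p ^ (i * 16 ^ (J + 1) + 16 ^ J)) *
        (X ^ p ^ 16 ^ J - X - C (approxConst Fq p S J i)) := by
  have h : ringHomT Fq (∑ k ∈ Finset.range (i * 16 ^ (J + 1) + 16 ^ J + 1),
      C (asCoeff Fq S (16 ^ J) k) * X ^ (p ^ (i * 16 ^ (J + 1) + 16 ^ J) - p ^ k)) =
      Tel Fq ^ p ^ (i * 16 ^ (J + 1) + 16 ^ J) * approxConst Fq p S J i := by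
    rw [approxConst, asTrunc, map_sum, map_sum, Finset.mul_sum]
    refine Finset.sum_congr rfl fun k hk => ?_
    rw [map_mul, map_pow, ringHomT_X, ringHomT_C, map_mul, map_pow, HahnSeries.ofPowerSeries_C,
      HahnSeries.ofPowerSeries_X, mul_left_comm, Tel_pow_mul_single_pow]
    exact Nat.pow_le_pow_right hp.pos (Nat.lt_succ_iff.1 (Finset.mem_range.1 hk))
  rw [approxPoly, Polynomial.map_sub, Polynomial.map_mul, map_C, map_C, h, map_pow, ringHomT_X,
    C_mul, ← mul_sub]
  simp

lemma natDegree_approxPoly (hp : p.Prime) (i : ℕ) :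
    (approxPoly Fq p S J i).natDegree = p ^ 16 ^ J := by
  rw [approxPoly, natDegree_sub_C, natDegree_C_mul (by simp),
    natDegree_sub_eq_left_of_natDegree_lt, natDegree_X_pow]
  rw [natDegree_X_pow, natDegree_X]
  exact Nat.one_lt_pow (by positivity) hp.one_lt

lemma natDegree_coeff_approxPoly_le (i m : ℕ) :
    ((approxPoly Fq p S J i).coeff m).natDegree ≤ p ^ (i * 16 ^ (J + 1) + 16 ^ J) := by
  rw [approxPoly, coeff_sub, coeff_C_mul, coeff_sub, coeff_X_pow, coeff_X, coeff_C]
  refine (natDegree_sub_le _ _).trans (max_le ?_ ?_)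
  · refine natDegree_mul_le.trans ?_
    rw [natDegree_X_pow]
    refine (Nat.add_le_add_left ((natDegree_sub_le _ _).trans (max_le ?_ ?_)) _).trans_eq
      (add_zero _)
    all_goals split_ifs <;> simp
  · split_ifs
    · refine natDegree_sum_le_of_forall_le _ _ fun k _ => (natDegree_C_mul_X_pow_le _ _).trans ?_
      exact Nat.sub_le _ _
    · simp

lemma coeff_approxPoly_natDegree (hp : p.Prime) (i : ℕ) :
    (approxPoly Fq p S J i).coeff (p ^ 16 ^ J) = X ^ p ^ (i * 16 ^ (J + 1) + 16 ^ J) := by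
  have h : 1 < p ^ 16 ^ J := Nat.one_lt_pow (by positivity) hp.one_lt
  rw [approxPoly, coeff_sub, coeff_C_mul, coeff_sub, coeff_X_pow, coeff_X, coeff_C,
    if_pos rfl, if_neg h.ne, if_neg (by lia)]
  simp

lemma approxPoly_ne_zero (hp : p.Prime) (i : ℕ) : approxPoly Fq p S J i ≠ 0 := by
  intro h
  have := coeff_approxPoly_natDegree (Fq := Fq) (S := S) (J := J) hp i
  rw [h, coeff_zero, eq_comm] at this
  simp at this

lemma heightP_approxPoly (hp : p.Prime) (q i : ℕ) :
    heightP Fq q (approxPoly Fq p S J i) = (q : ℝ) ^ p ^ (i * 16 ^ (J + 1) + 16 ^ J) := by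
  rw [heightP, if_neg (approxPoly_ne_zero hp i)]
  congr 1
  apply le_antisymm
  · exact Finset.sup_le fun m _ => natDegree_coeff_approxPoly_le i m
  · have h := coeff_approxPoly_natDegree (Fq := Fq) (S := S) (J := J) hp i
    refine le_trans ?_ (Finset.le_sup (f := fun m => ((approxPoly Fq p S J i).coeff m).natDegree)
      ((mem_support_iff (n := p ^ 16 ^ J)).2 ?_))
    · rw [h, natDegree_X_pow]
    · rw [h]
      simp

lemma evalP_approxPoly (hp : p.Prime) (i : ℕ) (ξ : LaurentSeries Fq) :
    evalP Fq ξ (approxPoly Fq p S J i) = Tel Fq ^ p ^ (i * 16 ^ (J + 1) + 16 ^ J) *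
      (ξ ^ p ^ 16 ^ J - ξ - approxConst Fq p S J i) := by
  rw [evalP, ← eval_map, map_approxPoly hp]
  simp

lemma absL_evalP_approxPoly_le [CharP Fq p] (hp : p.Prime) {q : ℕ} (hq : 1 < q) (i : ℕ) :
    absL Fq q (evalP Fq (gapNumber Fq p S) (approxPoly Fq p S J i)) ≤
      (q : ℝ) ^ ((p ^ (i * 16 ^ (J + 1) + 16 ^ J) : ℕ) - (p ^ ((i + 1) * 16 ^ (J + 1)) : ℕ) : ℤ) := by
  have hle : 16 ^ J ≤ (i + 1) * 16 ^ (J + 1) := by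
    rw [pow_succ]
    nlinarith [show 0 < 16 ^ J by positivity]
  have h := absL_ofPowerSeries_le hq (X_pow_dvd_gapSeries_pow_sub (Fq := Fq) hp S hle)
  rw [asTrunc_eq, map_sub, map_sub, map_pow] at h
  rw [evalP_approxPoly hp, absL_mul hq, absL_Tel_pow, sub_eq_add_neg (Nat.cast _ : ℤ),
    zpow_add₀ (by positivity), zpow_natCast]
  exact mul_le_mul_of_nonneg_left h (by positivity)

lemma approxConst_injective [CharP Fq p] (hp : p.Prime) (hJ : J + 1 ∈ S) :
    Function.Injective fun s : ℕ => approxConst Fq p S J (16 * s + 1) := fun _ _ h =>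
  asTrunc_injective hp hJ (HahnSeries.ofPowerSeries_injective h)

/-- A transcendence measure for `gapNumber Fq p S`. -/
lemma le_absL_evalP_gapNumber [CharP Fq p] (hp : p.Prime) {q : ℕ} (hq : 1 < q) (hJ : J + 1 ∈ S)
    {n : ℕ} (hn : n ≤ p ^ 16 ^ J) :
    ∃ c : ℕ, ∀ (P : Fq[X][X]) (h : ℕ), P ≠ 0 → P.natDegree ≤ n →
      (∀ i, (P.coeff i).natDegree ≤ h) →
      (q : ℝ) ^ (-(c * (h + 1) : ℤ)) ≤ absL Fq q (evalP Fq (gapNumber Fq p S) P) := by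
  set A := p ^ 16 ^ J with hA
  set B := p ^ 16 ^ (J + 1) with hB
  have hA2 : 2 ≤ A := Nat.one_lt_pow (by positivity) hp.one_lt
  have hBA : B = A ^ 16 := by rw [hA, hB, ← pow_mul, pow_succ]
  have hB1 : 1 < B := Nat.one_lt_pow (by positivity) hp.one_lt
  have hABlt : 3 * A + 2 * A ^ 2 < B := by
    have h4 : A ^ 5 ≤ B := hBA ▸ Nat.pow_le_pow_right (by lia) (by norm_num)
    have h3 : 2 ^ 3 ≤ A ^ 3 := Nat.pow_le_pow_left hA2 3
    nlinarith [Nat.mul_le_mul_right (A ^ 2) h3, show A ^ 5 = A ^ 3 * A ^ 2 by ring]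
  refine ⟨2 * A * (1 + A * B ^ (16 * (n + 1) + 1)), fun P h hP0 hPn hPh => ?_⟩
  set s₀ := Nat.log (B ^ 16) (h + 1) with hs₀
  have hB16 : 1 < B ^ 16 := Nat.one_lt_pow (by norm_num) hB1
  have hlog₁ : (B ^ 16) ^ s₀ ≤ h + 1 := Nat.pow_log_le_self _ (by lia)
  have hlog₂ : h + 1 < (B ^ 16) ^ (s₀ + 1) := Nat.lt_pow_succ_log_self hB16 _
  obtain ⟨t, htn, hcop⟩ := exists_isCoprime_sub_C (R := P.map (ringHomT Fq))
    ((Polynomial.map_ne_zero_iff ringHomT_injective).2 hP0) (natDegree_map_le.trans hPn)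
    (X ^ p ^ 16 ^ J - X)
    ((approxConst_injective (Fq := Fq) hp hJ).comp (add_right_injective (s₀ + 1)))
  simp only [Function.comp_apply] at hcop
  set i := 16 * (s₀ + 1 + t) + 1 with hi
  set Q := approxPoly Fq p S J i with hQ
  have hE : p ^ (i * 16 ^ (J + 1) + 16 ^ J) = A * B ^ i := by
    rw [pow_add, mul_comm i, pow_mul, mul_comm]
  have hE' : p ^ ((i + 1) * 16 ^ (J + 1)) = B * B ^ i := by
    rw [mul_comm, pow_mul, pow_succ, mul_comm]
  have hhi : h ≤ B ^ i := by
    rw [← pow_mul] at hlog₂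
    have : B ^ (16 * (s₀ + 1)) ≤ B ^ i := Nat.pow_le_pow_right hB1.le (by lia)
    lia
  have hiC : B ^ i ≤ (h + 1) * B ^ (16 * (n + 1) + 1) := by
    calc B ^ i ≤ B ^ (16 * s₀ + (16 * (n + 1) + 1)) := Nat.pow_le_pow_right hB1.le (by lia)
      _ = (B ^ 16) ^ s₀ * B ^ (16 * (n + 1) + 1) := by rw [pow_add, pow_mul]
      _ ≤ _ := Nat.mul_le_mul_right _ hlog₁
  have hres : P.resultant Q ≠ 0 := by
    intro h0
    have hcop' : IsCoprime (P.map (ringHomT Fq)) (Q.map (ringHomT Fq)) := by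
      rw [hQ, map_approxPoly hp, isCoprime_mul_unit_left_right]
      · exact hcop
      · refine isUnit_C.2 (pow_ne_zero _ ?_).isUnit
        simp [Tel]
    have h1 := congrArg (ringHomT Fq) h0
    rw [← resultant_map_map, map_zero,
      ← natDegree_map_eq_of_injective ringHomT_injective P,
      ← natDegree_map_eq_of_injective ringHomT_injective Q, resultant_eq_zero_iff] at h1
    exact h1.2 hcop'
  have hQA : Q.natDegree = A := natDegree_approxPoly hp i
  have key := one_le_max_mul_of_resultant_ne_zero (ξ := gapNumber Fq p S) (d := h + A * B ^ i) hq
    (absL_ofPowerSeries_le_one hq _) (fun j => (hPh j).trans (Nat.le_add_right _ _))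
    (fun j => (natDegree_coeff_approxPoly_le i j).trans (hE ▸ Nat.le_add_left _ _))
    (by rw [hQA]; lia) hres
  have hQle := absL_evalP_approxPoly_le (Fq := Fq) (S := S) (J := J) hp hq i
  rw [hE, hE', ← hQ] at hQle
  rw [hQA] at key
  have hq1 : (1 : ℝ) < q := by exact_mod_cast hq
  have hexp : (P.natDegree + A) * (h + A * B ^ i) ≤ 2 * A * (h + A * B ^ i) :=
    Nat.mul_le_mul_right _ (by lia)
  rcases le_total (absL Fq q (evalP Fq (gapNumber Fq p S) P))
    (absL Fq q (evalP Fq (gapNumber Fq p S) Q)) with hle | hle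
  · exfalso
    rw [max_eq_right hle] at key
    have hnum : 2 * A * (h + A * B ^ i) + A * B ^ i < B * B ^ i := by
      have := Nat.mul_lt_mul_of_pos_right hABlt (show 0 < B ^ i by positivity)
      nlinarith [Nat.mul_le_mul_left (2 * A) hhi]
    have : (1 : ℝ) < 1 := by
      calc (1 : ℝ) ≤ _ := key
        _ ≤ (q : ℝ) ^ (((A * B ^ i : ℕ) : ℤ) - ((B * B ^ i : ℕ) : ℤ)) *
            (q : ℝ) ^ ((P.natDegree + A) * (h + A * B ^ i)) := by gcongr
        _ = (q : ℝ) ^ (((A * B ^ i : ℕ) : ℤ) - ((B * B ^ i : ℕ) : ℤ) +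
            (((P.natDegree + A) * (h + A * B ^ i) : ℕ) : ℤ)) := by
          rw [zpow_add₀ (by positivity), zpow_natCast]
        _ < 1 := zpow_lt_one_of_neg₀ hq1 (by lia)
    exact lt_irrefl _ this
  · rw [max_eq_left hle] at key
    have hd : (P.natDegree + A) * (h + A * B ^ i) ≤
        2 * A * (1 + A * B ^ (16 * (n + 1) + 1)) * (h + 1) := by
      refine hexp.trans ?_
      rw [mul_assoc (2 * A)]
      refine Nat.mul_le_mul_left _ ?_
      nlinarith [Nat.mul_le_mul_left A hiC]
    calc (q : ℝ) ^ (-(((2 * A * (1 + A * B ^ (16 * (n + 1) + 1)) : ℕ) : ℤ) * (h + 1) : ℤ))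
        ≤ (q : ℝ) ^ (-(((P.natDegree + A) * (h + A * B ^ i) : ℕ) : ℤ)) := by
          refine zpow_le_zpow_right₀ hq1.le (neg_le_neg ?_)
          exact_mod_cast hd
      _ ≤ _ := by
          rw [zpow_neg, zpow_natCast]
          exact (inv_le_iff_one_le_mul₀ (by positivity)).2 key

end Approximation

section Exponents

variable {Fq : Type} [Field Fq] {p q : ℕ} {S : Set ℕ}

lemma finite_setOf_natDegree_coeff_eq_zero [Finite Fq] (n : ℕ) :
    {P : Fq[X][X] | P.natDegree ≤ n ∧ ∀ i, (P.coeff i).natDegree = 0}.Finite := by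
  refine (Set.finite_range fun f : Fin (n + 1) → Fq =>
    ∑ i, C (C (f i)) * (X : Fq[X][X]) ^ (i : ℕ)).subset ?_
  rintro P ⟨hn, hP⟩
  refine ⟨fun i => (P.coeff i).coeff 0, ?_⟩
  conv_rhs => rw [P.as_sum_range_C_mul_X_pow' (Nat.lt_succ_iff.2 hn),
    ← Fin.sum_univ_eq_sum_range fun i => C (P.coeff i) * X ^ i]
  exact Finset.sum_congr rfl fun i _ => by rw [← eq_C_of_natDegree_eq_zero (hP i)]

lemma wn_gapNumber_lt_top [Finite Fq] [CharP Fq p] (hp : p.Prime) (hq : 1 < q) (hS : S.Infinite)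
    (n : ℕ) : wn Fq q n (gapNumber Fq p S) < ⊤ := by
  obtain ⟨m, hm, hnm⟩ := hS.exists_gt n
  obtain ⟨J, rfl⟩ := Nat.exists_eq_add_one_of_ne_zero (by lia : m ≠ 0)
  have hnJ : n ≤ p ^ 16 ^ J := (Nat.lt_succ_iff.1 hnm).trans <|
    (Nat.lt_pow_self (by norm_num)).le.trans (Nat.lt_pow_self hp.one_lt).le
  obtain ⟨c, hc⟩ := le_absL_evalP_gapNumber (Fq := Fq) hp hq hm hnJ
  refine (sSup_le ?_ : _ ≤ ((2 * c : ℝ) : EReal)).trans_lt (EReal.coe_lt_top _)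
  rintro _ ⟨w, hw, rfl⟩
  by_contra! hlt
  have hcw : 2 * (c : ℝ) < w := EReal.coe_lt_coe_iff.1 hlt
  refine hw ((finite_setOf_natDegree_coeff_eq_zero (Fq := Fq) n).subset ?_)
  rintro P ⟨hPn, hpos, hle⟩
  have hP0 : P ≠ 0 := by
    rintro rfl
    simp [evalP, absL_zero] at hpos
  rw [heightP, if_neg hP0] at hle
  set h := P.support.sup fun i => (P.coeff i).natDegree with hh
  have hcoeff : ∀ i, (P.coeff i).natDegree ≤ h := fun i => by
    by_cases hi : i ∈ P.support
    · exact Finset.le_sup (f := fun i => (P.coeff i).natDegree) hi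
    · simp [notMem_support_iff.1 hi]
  suffices h = 0 from ⟨hPn, fun i => Nat.le_zero.1 (this ▸ hcoeff i)⟩
  by_contra h0
  have h1 : (1 : ℝ) ≤ h := by exact_mod_cast Nat.one_le_iff_ne_zero.2 h0
  have hq1 : (1 : ℝ) < q := by exact_mod_cast hq
  have key := (hc P h hP0 hPn hcoeff).trans hle
  rw [← Real.rpow_intCast, ← Real.rpow_natCast, ← Real.rpow_mul (by positivity),
    Real.rpow_le_rpow_left_iff hq1] at key
  push_cast at key
  nlinarith [(Nat.cast_nonneg c : (0 : ℝ) ≤ c)]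

lemma le_wn_gapNumber [CharP Fq p] (hp : p.Prime) (hq : 1 < q) {J : ℕ} (hJ : J + 1 ∈ S) :
    (((p ^ 16 ^ J : ℕ) ^ 15 - 1 : ℝ) : EReal) ≤ wn Fq q (p ^ 16 ^ J) (gapNumber Fq p S) := by
  set A := p ^ 16 ^ J with hA
  refine le_sSup ⟨_, ?_, rfl⟩
  set ξ := gapNumber Fq p S with hξ
  have hinf : {s : ℕ | approxConst Fq p S J (16 * s + 1) = ξ ^ A - ξ}ᶜ.Infinite := by
    refine Set.Finite.infinite_compl (Set.Subsingleton.finite fun s hs t ht => ?_)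
    exact approxConst_injective hp hJ (hs.trans ht.symm)
  have hinj : Function.Injective fun s : ℕ => approxPoly Fq p S J (16 * s + 1) := by
    intro s t hst
    have h := congrArg (fun P => (P.coeff (p ^ 16 ^ J)).natDegree) hst
    simp only [coeff_approxPoly_natDegree hp, natDegree_X_pow] at h
    have h' := Nat.pow_right_injective hp.two_le h
    simpa using h'
  refine (hinf.image hinj.injOn).mono ?_
  rintro _ ⟨s, hs, rfl⟩
  have hne : evalP Fq ξ (approxPoly Fq p S J (16 * s + 1)) ≠ 0 := by
    rw [evalP_approxPoly hp]
    exact mul_ne_zero (pow_ne_zero _ (by simp [Tel])) (sub_ne_zero.2 (Ne.symm hs))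
  refine ⟨(natDegree_approxPoly hp _).le, absL_pos hq hne, ?_⟩
  refine (absL_evalP_approxPoly_le hp hq _).trans_eq ?_
  set i := 16 * s + 1
  have hE : p ^ ((i + 1) * 16 ^ (J + 1)) = p ^ (i * 16 ^ (J + 1) + 16 ^ J) * A ^ 15 := by
    rw [hA, ← pow_mul, ← pow_add]
    congr 1
    ring
  rw [heightP_approxPoly hp, hE, ← Real.rpow_intCast, ← Real.rpow_natCast,
    ← Real.rpow_mul (by positivity)]
  congr 1
  push_cast
  ring

lemma wB_gapNumber [CharP Fq p] (hp : p.Prime) (hq : 1 < q) (hS : S.Infinite) :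
    wB Fq q (gapNumber Fq p S) = ⊤ := by
  rw [EReal.eq_top_iff_forall_lt]
  intro y
  refine (EReal.coe_lt_coe_iff.2 (lt_add_one y)).trans_le (le_limsup_of_frequently_le ?_)
  rw [frequently_atTop]
  intro N
  obtain ⟨k, hk⟩ := exists_nat_ge (y + 1)
  obtain ⟨m, hm, hlt⟩ := hS.exists_gt (N + k)
  obtain ⟨J, rfl⟩ := Nat.exists_eq_add_one_of_ne_zero (by lia : m ≠ 0)
  have hJA : J ≤ p ^ 16 ^ J :=
    (Nat.lt_pow_self (by norm_num)).le.trans (Nat.lt_pow_self hp.one_lt).le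
  have hA : 2 ≤ p ^ 16 ^ J := Nat.one_lt_pow (by positivity) hp.one_lt
  have hwn := le_wn_gapNumber (Fq := Fq) hp hq hm
  refine ⟨p ^ 16 ^ J, by lia, le_trans ?_ (EReal.div_le_div_right_of_nonneg (by positivity) hwn)⟩
  generalize p ^ 16 ^ J = A at *
  have hA' : (2 : ℝ) ≤ A := by exact_mod_cast hA
  have hkA : (k : ℝ) ≤ A := by exact_mod_cast (by lia : k ≤ A)
  rw [← EReal.coe_coe_eq_natCast, ← EReal.coe_div, EReal.coe_le_coe_iff, le_div_iff₀ (by positivity)]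
  have h3 : (A : ℝ) ^ 3 ≤ (A : ℝ) ^ 15 := pow_le_pow_right₀ (by linarith) (by norm_num)
  have h2 : (y + 1) * A ≤ A * A := by gcongr; linarith
  nlinarith

lemma isTNumber_gapNumber [Finite Fq] [CharP Fq p] (hp : p.Prime) (hq : 1 < q) (hS : S.Infinite) :
    IsTNumber Fq q (gapNumber Fq p S) :=
  ⟨wB_gapNumber hp hq hS, fun n _ => wn_gapNumber_lt_top hp hq hS n⟩

lemma gapNumber_injective [CharP Fq p] (hp : p.Prime) : Function.Injective (gapNumber Fq p) :=
  HahnSeries.ofPowerSeries_injective.comp (gapSeries_injective hp)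

end Exponents

/-- The set of even numbers together with the odd numbers `2 * m + 1` for `m ∈ S`. -/
def evenUnion (S : Set ℕ) : Set ℕ := {m | Even m ∨ m / 2 ∈ S}

lemma infinite_evenUnion (S : Set ℕ) : (evenUnion S).Infinite :=
  Set.infinite_of_injective_forall_mem (f := fun m => 2 * m) (fun _ _ h => by simpa using h)
    fun _ => Or.inl (even_two_mul _)

lemma evenUnion_injective : Function.Injective evenUnion := by
  intro S S' h
  ext m
  have h' := Set.ext_iff.1 h (2 * m + 1)
  simpa [evenUnion, show (2 * m + 1) / 2 = m by lia] using h'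

end OotoT

/-- The set of `T`-numbers in `F_q((T⁻¹))` is uncountable. -/
theorem tNumbers_uncountable (p : ℕ) (hp : p.Prime) (q : ℕ) (hq : ∃ e : ℕ, 0 < e ∧ q = p ^ e)
    (Fq : Type) [Field Fq] [Fintype Fq] [CharP Fq p] (hcard : Fintype.card Fq = q) :
    ¬ Set.Countable {ξ : LaurentSeries Fq | IsTNumber Fq q ξ} := by
  have hq1 : 1 < q := by
    obtain ⟨e, he, rfl⟩ := hq
    exact Nat.one_lt_pow he.ne' hp.one_lt
  intro hcount
  have hT : ∀ S : Set ℕ, gapNumber Fq p (evenUnion S) ∈ {ξ : LaurentSeries Fq | IsTNumber Fq q ξ} :=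
    fun S => isTNumber_gapNumber hp hq1 (infinite_evenUnion S)
  have := hcount.to_subtype
  have hinj : Function.Injective
      fun S : Set ℕ => (⟨_, hT S⟩ : {ξ : LaurentSeries Fq | IsTNumber Fq q ξ}) := fun S S' h =>
    evenUnion_injective (gapNumber_injective hp (congrArg Subtype.val h))
  have : Countable (Set ℕ) := hinj.countable
  obtain ⟨f, hf⟩ := exists_injective_nat (Set ℕ)
  exact Function.cantor_injective f hf
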